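/- Let q ≥ 1, let A ⊆ ℝ^q be nonempty, compact and convex, let P ⊆ ℝ^q be compact and convex with A ⊆ P, and let M ∈ ℝ^{q×q} be symmetric positive definite with m I ⪯ M ⪯ M′ I for some 0 < m ≤ M′. Let v ∈ P satisfy d_M(v,A) = sup_{u∈P} d_M(u,A), let y ∈ A satisfy ‖v − y‖_M = d_M(v,A), set g := M(y − v), H := {w ∈ ℝ^q : gᵀw ≥ gᵀy}, and P′ := P ∩ H. Then A ⊆ P′ and δ_H(P, P′; ‖·‖_2) ≥ (m/M′)^{3/2} · δ_H(P, A; ‖·‖_2); that is, each cut removes at least the fraction (m/M′)^{3/2} of the current Euclidean Hausdorff error. -/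

import Mathlib

open Matrix Set
open scoped ENNReal

/-- The norm induced by a symmetric positive definite matrix `M`. -/
noncomputable def mnorm {q : ℕ} (M : Matrix (Fin q) (Fin q) ℝ) (y : Fin q → ℝ) : ℝ :=
  Real.sqrt (y ⬝ᵥ M.mulVec y)

/-- The Euclidean norm on `Fin q → ℝ`. -/
noncomputable def enorm2 {q : ℕ} (y : Fin q → ℝ) : ℝ :=
  Real.sqrt (y ⬝ᵥ y)

/-- Hausdorff distance (valued in `[0,∞]`) of two sets with respect to a given norm. -/
noncomputable def hdistN {q : ℕ} (nrm : (Fin q → ℝ) → ℝ) (A B : Set (Fin q → ℝ)) : ℝ≥0∞ :=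
  max (⨆ a ∈ A, ⨅ b ∈ B, ENNReal.ofReal (nrm (a - b)))
      (⨆ b ∈ B, ⨅ a ∈ A, ENNReal.ofReal (nrm (a - b)))

/-- Distance from a point to a set in the `M`-norm. -/
noncomputable def dM {q : ℕ} (M : Matrix (Fin q) (Fin q) ℝ) (v : Fin q → ℝ)
    (S : Set (Fin q → ℝ)) : ℝ :=
  sInf ((fun y => mnorm M (v - y)) '' S)

/-- Lower spectral bound as a bound on the quadratic form. -/
lemma smul_dotProduct_le_of_posSemidef {q : ℕ} {M : Matrix (Fin q) (Fin q) ℝ} {m : ℝ}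
    (h : (M - m • (1 : Matrix (Fin q) (Fin q) ℝ)).PosSemidef) (x : Fin q → ℝ) :
    m * (x ⬝ᵥ x) ≤ x ⬝ᵥ M.mulVec x := by
  have := h.dotProduct_mulVec_nonneg x
  simpa [sub_mulVec, smul_mulVec] using this

/-- Upper spectral bound as a bound on the quadratic form. -/
lemma dotProduct_le_smul_of_posSemidef {q : ℕ} {M : Matrix (Fin q) (Fin q) ℝ} {m : ℝ}
    (h : (m • (1 : Matrix (Fin q) (Fin q) ℝ) - M).PosSemidef) (x : Fin q → ℝ) :
    x ⬝ᵥ M.mulVec x ≤ m * (x ⬝ᵥ x) := by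
  have := h.dotProduct_mulVec_nonneg x
  simpa [sub_mulVec, smul_mulVec] using this

lemma sqrt_mul_enorm2_le_mnorm {q : ℕ} {M : Matrix (Fin q) (Fin q) ℝ} {m : ℝ} (hm : 0 ≤ m)
    (h : (M - m • (1 : Matrix (Fin q) (Fin q) ℝ)).PosSemidef) (x : Fin q → ℝ) :
    √m * enorm2 x ≤ mnorm M x := by
  rw [enorm2, mnorm, ← Real.sqrt_mul hm]
  exact Real.sqrt_le_sqrt (smul_dotProduct_le_of_posSemidef h x)

lemma mnorm_le_sqrt_mul_enorm2 {q : ℕ} {M : Matrix (Fin q) (Fin q) ℝ} {m : ℝ} (hm : 0 ≤ m)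
    (h : (m • (1 : Matrix (Fin q) (Fin q) ℝ) - M).PosSemidef) (x : Fin q → ℝ) :
    mnorm M x ≤ √m * enorm2 x := by
  rw [enorm2, mnorm, ← Real.sqrt_mul hm]
  exact Real.sqrt_le_sqrt (dotProduct_le_smul_of_posSemidef h x)

lemma Matrix.IsHermitian.mulVec_dotProduct_comm {q : ℕ} {M : Matrix (Fin q) (Fin q) ℝ}
    (hM : M.IsHermitian) (x z : Fin q → ℝ) : M.mulVec x ⬝ᵥ z = x ⬝ᵥ M.mulVec z := by
  have hT : Mᵀ = M := by simpa [conjTranspose_eq_transpose_of_trivial] using hM.eq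
  rw [dotProduct_mulVec, ← mulVec_transpose, hT]

lemma Matrix.IsHermitian.quadratic_add_smul {q : ℕ} {M : Matrix (Fin q) (Fin q) ℝ}
    (hM : M.IsHermitian) (x z : Fin q → ℝ) (t : ℝ) :
    (x + t • z) ⬝ᵥ M.mulVec (x + t • z) =
      x ⬝ᵥ M.mulVec x + 2 * t * (M.mulVec x ⬝ᵥ z) + t ^ 2 * (z ⬝ᵥ M.mulVec z) := by
  have h₁ := hM.mulVec_dotProduct_comm x z
  have h₂ := dotProduct_comm (M.mulVec x) z
  simp only [mulVec_add, mulVec_smul, add_dotProduct, dotProduct_add, smul_dotProduct,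
    dotProduct_smul, smul_eq_mul]
  rw [← h₁, ← h₂]
  ring

lemma continuous_mnorm {q : ℕ} (M : Matrix (Fin q) (Fin q) ℝ) : Continuous (mnorm M) := by
  unfold mnorm
  fun_prop

lemma dM_le_mnorm {q : ℕ} (M : Matrix (Fin q) (Fin q) ℝ) (u : Fin q → ℝ)
    {S : Set (Fin q → ℝ)} {a : Fin q → ℝ} (ha : a ∈ S) : dM M u S ≤ mnorm M (u - a) :=
  csInf_le ⟨0, by rintro _ ⟨b, -, rfl⟩; exact Real.sqrt_nonneg _⟩ ⟨a, ha, rfl⟩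

lemma IsCompact.exists_mnorm_le_dM {q : ℕ} (M : Matrix (Fin q) (Fin q) ℝ)
    {A : Set (Fin q → ℝ)} (hA : IsCompact A) (hne : A.Nonempty) (u : Fin q → ℝ) :
    ∃ a ∈ A, mnorm M (u - a) ≤ dM M u A := by
  have hc : Continuous fun a => mnorm M (u - a) :=
    (continuous_mnorm M).comp (by fun_prop)
  obtain ⟨a, ha, hmin⟩ := hA.exists_isMinOn hne hc.continuousOn
  refine ⟨a, ha, le_csInf (hne.image _) ?_⟩
  rintro _ ⟨b, hb, rfl⟩
  exact hmin hb

lemma IsCompact.bddAbove_dM {q : ℕ} (M : Matrix (Fin q) (Fin q) ℝ)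
    {A P : Set (Fin q → ℝ)} (hP : IsCompact P) (hne : A.Nonempty) :
    BddAbove ((fun u => dM M u A) '' P) := by
  obtain ⟨a, ha⟩ := hne
  have hc : Continuous fun u => mnorm M (u - a) :=
    (continuous_mnorm M).comp (by fun_prop)
  obtain ⟨C, hC⟩ := hP.bddAbove_image hc.continuousOn
  refine ⟨C, ?_⟩
  rintro _ ⟨u, hu, rfl⟩
  exact (dM_le_mnorm M u ha).trans (hC ⟨u, hu, rfl⟩)

/-- Variational inequality for an `M`-nearest point of a convex set. -/
lemma dotProduct_le_of_mnorm_eq_dM {q : ℕ} {M : Matrix (Fin q) (Fin q) ℝ} (hM : M.PosSemidef)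
    {A : Set (Fin q → ℝ)} (hA : Convex ℝ A) {v y : Fin q → ℝ} (hy : y ∈ A)
    (hnear : mnorm M (v - y) = dM M v A) {a : Fin q → ℝ} (ha : a ∈ A) :
    M.mulVec (y - v) ⬝ᵥ y ≤ M.mulVec (y - v) ⬝ᵥ a := by
  have hnn : ∀ x : Fin q → ℝ, 0 ≤ x ⬝ᵥ M.mulVec x := fun x => by
    simpa using hM.dotProduct_mulVec_nonneg x
  have key : ∀ t : ℝ, 0 < t → t ≤ 1 →
      0 ≤ 2 * (M.mulVec (y - v) ⬝ᵥ (a - y)) + t * ((a - y) ⬝ᵥ M.mulVec (a - y)) := by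
    intro t ht ht1
    have hmem : y + t • (a - y) ∈ A := hA.add_smul_sub_mem hy ha ⟨ht.le, ht1⟩
    have h := hnear.le.trans (dM_le_mnorm M v hmem)
    rw [mnorm, mnorm, Real.sqrt_le_sqrt_iff (hnn _)] at h
    have e₁ : v - (y + t • (a - y)) = -((y - v) + t • (a - y)) := by abel
    have e₂ : v - y = -(y - v) := by abel
    rw [e₁, e₂] at h
    simp only [mulVec_neg, neg_dotProduct_neg] at h
    rw [hM.isHermitian.quadratic_add_smul] at h
    refine nonneg_of_mul_nonneg_right (a := t) ?_ ht
    linarith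
  have hlim : 0 ≤ 2 * (M.mulVec (y - v) ⬝ᵥ (a - y)) := by
    set c := (a - y) ⬝ᵥ M.mulVec (a - y)
    set b := M.mulVec (y - v) ⬝ᵥ (a - y)
    by_contra! hb
    have hc : 0 ≤ c := hnn _
    have hpos : 0 < c - 2 * b := by linarith
    have h := key (-b / (c - 2 * b)) (div_pos (by linarith) hpos)
      ((div_le_one hpos).2 (by linarith))
    have hlt : -b / (c - 2 * b) * c ≤ -b := by
      rw [div_mul_eq_mul_div, div_le_iff₀ hpos]
      nlinarith
    linarith
  rw [dotProduct_sub] at hlim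
  linarith

/-- The cutting hyperplane at `y` is at `M`-distance at least `‖v - y‖_M` from `v`. -/
lemma mnorm_le_of_dotProduct_le {q : ℕ} {M : Matrix (Fin q) (Fin q) ℝ} (hM : M.PosSemidef)
    {v y w : Fin q → ℝ} (hw : M.mulVec (y - v) ⬝ᵥ y ≤ M.mulVec (y - v) ⬝ᵥ w) :
    mnorm M (v - y) ≤ mnorm M (v - w) := by
  have h : 0 ≤ (w - y) ⬝ᵥ M.mulVec (w - y) := by
    simpa using hM.dotProduct_mulVec_nonneg (w - y)
  have e₁ : v - w = -((y - v) + (1 : ℝ) • (w - y)) := by rw [one_smul]; abel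
  have e₂ : v - y = -(y - v) := by abel
  rw [mnorm, mnorm, e₁, e₂]
  simp only [mulVec_neg, neg_dotProduct_neg]
  refine Real.sqrt_le_sqrt ?_
  rw [hM.isHermitian.quadratic_add_smul, dotProduct_sub]
  linarith

/-- single-step cut-ratio inequality.  With `mI ⪯ M ⪯ M′I`, a farthest
point `v ∈ P` in the `M`-metric, its `M`-nearest point `y ∈ A`, normal `g = M(y−v)`,
halfspace `H = {w : gᵀw ≥ gᵀy}`, and `P′ = P ∩ H`, one has `A ⊆ P′` and
`δ_H(P,P′;‖·‖₂) ≥ (m/M′)^{3/2}·δ_H(P,A;‖·‖₂)`. -/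
theorem stmt17 {q : ℕ} (hq : 1 ≤ q)
    (A P : Set (Fin q → ℝ)) (hAne : A.Nonempty) (hAcomp : IsCompact A)
    (hAconv : Convex ℝ A) (hPcomp : IsCompact P) (hPconv : Convex ℝ P) (hAP : A ⊆ P)
    (M : Matrix (Fin q) (Fin q) ℝ) (hMpd : M.PosDef)
    (m M' : ℝ) (hm : 0 < m) (hmM : m ≤ M')
    (hlow : (M - m • (1 : Matrix (Fin q) (Fin q) ℝ)).PosSemidef)
    (hup : (M' • (1 : Matrix (Fin q) (Fin q) ℝ) - M).PosSemidef)
    (v : Fin q → ℝ) (hvP : v ∈ P)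
    (hmax : dM M v A = sSup ((fun u => dM M u A) '' P))
    (y : Fin q → ℝ) (hyA : y ∈ A) (hnear : mnorm M (v - y) = dM M v A)
    (g : Fin q → ℝ) (hg : g = M.mulVec (y - v))
    (H : Set (Fin q → ℝ)) (hH : H = {w | g ⬝ᵥ y ≤ g ⬝ᵥ w})
    (P' : Set (Fin q → ℝ)) (hP' : P' = P ∩ H) :
    A ⊆ P' ∧
    ENNReal.ofReal ((m / M') ^ ((3 : ℝ) / 2)) * hdistN enorm2 P A
      ≤ hdistN enorm2 P P' := by
  have hM := hMpd.posSemidef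
  have hM' : 0 < M' := hm.trans_le hmM
  have hAP' : A ⊆ P' := by
    intro a ha
    subst hP' hH hg
    exact ⟨hAP ha, dotProduct_le_of_mnorm_eq_dM hM hAconv hyA hnear ha⟩
  refine ⟨hAP', ?_⟩
  set D := mnorm M (v - y)
  have hD : 0 ≤ D := Real.sqrt_nonneg _
  have hsm : 0 < √m := Real.sqrt_pos.2 hm
  have hsM : 0 < √M' := Real.sqrt_pos.2 hM'
  have hPA : hdistN enorm2 P A ≤ ENNReal.ofReal (D / √m) := by
    refine max_le (iSup₂_le fun u hu => ?_) (iSup₂_le fun a ha => ?_)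
    · obtain ⟨a, ha, hle⟩ := hAcomp.exists_mnorm_le_dM M hAne u
      refine (iInf₂_le a ha).trans (ENNReal.ofReal_le_ofReal ?_)
      rw [le_div_iff₀' hsm]
      refine (sqrt_mul_enorm2_le_mnorm hm.le hlow _).trans (hle.trans ?_)
      rw [hnear, hmax]
      exact le_csSup (hPcomp.bddAbove_dM M hAne) ⟨u, hu, rfl⟩
    · refine (iInf₂_le a (hAP ha)).trans ?_
      simp [enorm2]
  have hPP' : ENNReal.ofReal (D / √M') ≤ hdistN enorm2 P P' := by
    refine le_max_of_le_left (le_iSup₂_of_le v hvP (le_iInf₂ fun w hw => ?_))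
    refine ENNReal.ofReal_le_ofReal ?_
    rw [div_le_iff₀' hsM]
    subst hP' hH hg
    exact (mnorm_le_of_dotProduct_le hM hw.2).trans (mnorm_le_sqrt_mul_enorm2 hM'.le hup _)
  have hratio : (m / M') ^ ((3 : ℝ) / 2) ≤ √m / √M' := by
    rw [← Real.sqrt_div hm.le, Real.sqrt_eq_rpow]
    exact Real.rpow_le_rpow_of_exponent_ge (div_pos hm hM') ((div_le_one hM').2 hmM)
      (by norm_num)
  calc ENNReal.ofReal ((m / M') ^ ((3 : ℝ) / 2)) * hdistN enorm2 P A
      ≤ ENNReal.ofReal (√m / √M') * ENNReal.ofReal (D / √m) := by gcongr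
    _ = ENNReal.ofReal (D / √M') := by
      rw [← ENNReal.ofReal_mul (by positivity)]
      congr 1
      field_simp
    _ ≤ hdistN enorm2 P P' := hPP'
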